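/- In the modification setup, assume conditions (C1) and (C2). Then for all x, u, v ∈ G the middle inner mapping T(x) commutes with the left and right inner mappings: T(x)∘L(u,v) = L(u,v)∘T(x) and T(x)∘R(u,v) = R(u,v)∘T(x) as maps G → G. -/

import Mathlib

/-- In the modification setup, under (C1) and (C2), the middle inner mappings commute
with the left and right inner mappings. -/
theorem stmt_6 {G : Type*} [Group G] (Z K N : Subgroup G)
    (hZK : Z ≤ K) (hKN : K ≤ N)
    (hNnormal : N.Normal)
    (hNab : ∀ a ∈ N, ∀ b ∈ N, a * b = b * a)
    (hGN : ∀ x y : G, x⁻¹ * y⁻¹ * x * y ∈ N)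
    (hZcentral : Z ≤ Subgroup.center G)
    (hKnormal : K.Normal)
    (hNK : ∀ n ∈ N, ∀ g : G, n⁻¹ * g⁻¹ * n * g ∈ K)
    (μ : G → G → G)
    (hμZ : ∀ x y : G, μ x y ∈ Z)
    (hμK : ∀ x x' y y' : G, x⁻¹ * x' ∈ K → y⁻¹ * y' ∈ K → μ x y = μ x' y')
    (hμ1 : ∀ x : G, μ x 1 = 1) (hμ1' : ∀ x : G, μ 1 x = 1)
    (A : G → G → G → G)
    (hA : ∀ x y z : G, A x y z = μ x y * μ (x * y) z * (μ x (y * z))⁻¹ * (μ y z)⁻¹)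
    (L : G → G → G → G) (hL : ∀ x y w : G, L x y w = w * A x y w)
    (R : G → G → G → G) (hR : ∀ x y w : G, R x y w = w * A w x y)
    (T : G → G → G)
    (hT : ∀ x w : G, T x w = (x⁻¹ * w * x) * μ w x * (μ x (x⁻¹ * w * x))⁻¹)
    (hC1 : ∀ x y z : G, (x ∈ N ∨ y ∈ N ∨ z ∈ N) → μ (x * y) z = μ x z * μ y z)
    (hC2 : ∀ x y z : G, (x ∈ N ∨ y ∈ N ∨ z ∈ N) → μ x (y * z) = μ x y * μ x z) :
    ∀ x u v : G,
      T x ∘ L u v = L u v ∘ T x ∧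
      T x ∘ R u v = R u v ∘ T x := by
  obtain ⟨ν, hν⟩ : ∃ ν : G → G → Subgroup.center G, ∀ x y, μ x y = ν x y :=
    ⟨fun x y => ⟨μ x y, hZcentral (hμZ x y)⟩, fun _ _ => rfl⟩
  have c1 : ∀ x y z : G, (x ∈ N ∨ y ∈ N ∨ z ∈ N) → ν (x * y) z = ν x z * ν y z := by
    intro x y z h
    apply Subtype.ext
    have := hC1 x y z h
    simpa [hν] using this
  have c2 : ∀ x y z : G, (x ∈ N ∨ y ∈ N ∨ z ∈ N) → ν x (y * z) = ν x y * ν x z := by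
    intro x y z h
    apply Subtype.ext
    have := hC2 x y z h
    simpa [hν] using this
  have hA' : ∀ x y z : G, A x y z =
      ((ν x y * ν (x * y) z * (ν x (y * z))⁻¹ * (ν y z)⁻¹ : Subgroup.center G) : G) := by
    intro x y z
    simp [hA, hν]
  have hAZ : ∀ x y z, A x y z ∈ Z := by
    intro x y z
    rw [hA]
    exact Z.mul_mem (Z.mul_mem (Z.mul_mem (hμZ _ _) (hμZ _ _)) (Z.inv_mem (hμZ _ _)))
      (Z.inv_mem (hμZ _ _))
  have AL : ∀ u v w m, m ∈ N → A u v (w * m) = A u v w := by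
    intro u v w m hm
    rw [hA', hA']
    congr 1
    rw [← mul_assoc v w m, c2 (u * v) w m (by simp [hm]), c2 u (v * w) m (by simp [hm]),
      c2 v w m (by simp [hm]), c1 u v m (by simp [hm])]
    simp only [mul_inv_rev]
    have : ∀ a b c d e f : Subgroup.center G,
      a * (b * (c * d)) * (c⁻¹ * e) * (d⁻¹ * f) = a * b * e * f := by
      intro a b c d e f
      calc _ = a * b * e * f * (c * c⁻¹) * (d * d⁻¹) := by ac_rfl
        _ = _ := by simp
    exact this _ _ _ _ _ _
  have AR : ∀ u v w m, m ∈ N → A (w * m) u v = A w u v := by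
    intro u v w m hm
    have hm' : u⁻¹ * m * u ∈ N := by
      simpa using hNnormal.conj_mem m hm u⁻¹
    have e : ν (u⁻¹ * m * u) v = ν m v := by
      apply Subtype.ext
      rw [← hν, ← hν]
      refine (hμK _ _ _ _ ?_ (by simp)).symm
      simpa [mul_assoc] using hNK m hm u
    rw [hA', hA']
    congr 1
    rw [show w * m * u = (w * u) * (u⁻¹ * m * u) by group,
      c1 (w * u) (u⁻¹ * m * u) v (by simp [hm']), e, c1 w m u (by simp [hm]),
      c1 w m (u * v) (by simp [hm]), c2 m u v (by simp [hm])]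
    simp only [mul_inv_rev]
    have : ∀ a b c d e f : Subgroup.center G,
      a * b * (c * d) * (d⁻¹ * b⁻¹ * e) * f = a * c * e * f := by
      intro a b c d e f
      calc _ = a * c * e * f * (b * b⁻¹) * (d * d⁻¹) := by ac_rfl
        _ = _ := by simp
    exact this _ _ _ _ _ _
  have hTm : ∀ x w, ∃ m ∈ N, T x w = w * m := by
    intro x w
    refine ⟨(w⁻¹ * x⁻¹ * w * x) * (μ w x * (μ x (x⁻¹ * w * x))⁻¹), ?_, ?_⟩
    · exact N.mul_mem (hGN w x) (hKN (hZK (Z.mul_mem (hμZ _ _) (Z.inv_mem (hμZ _ _)))))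
    · rw [hT]; group
  have hTz : ∀ x w a, a ∈ Z → T x (w * a) = T x w * a := by
    intro x w a ha
    have hc : ∀ g, g * a = a * g := Subgroup.mem_center_iff.1 (hZcentral ha)
    have e0 : x⁻¹ * (w * a) * x = x⁻¹ * w * x * a := by
      simp only [mul_assoc, hc x]
    have e1 : μ (w * a) x = μ w x := (hμK _ _ _ _ (by simpa using hZK ha) (by simp)).symm
    have e2 : μ x (x⁻¹ * w * x * a) = μ x (x⁻¹ * w * x) :=
      (hμK _ _ _ _ (by simp) (by
        rw [inv_mul_cancel_left]; exact hZK ha)).symm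
    rw [hT, hT, e0, e1, e2]
    rw [mul_assoc _ a, ← hc, mul_assoc _ _ (μ x _)⁻¹, mul_assoc _ a, ← hc]
    simp only [mul_assoc]
  intro x u v
  constructor
  · funext w
    obtain ⟨m, hm, e⟩ := hTm x w
    simp only [Function.comp, hL]
    rw [hTz _ _ _ (hAZ _ _ _), e, AL _ _ _ _ hm]
  · funext w
    obtain ⟨m, hm, e⟩ := hTm x w
    simp only [Function.comp, hR]
    rw [hTz _ _ _ (hAZ _ _ _), e, AR _ _ _ _ hm]
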